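/- arXiv:2006.14366 — 5 statements merged into one kernel-verified Lean document; each statement's English description precedes it below -/
import Mathlib

section
/- Let M ≥ 2 be an integer and N_1,…,N_M positive integers that are not all equal, with N := N_1+…+N_M. For every θ ∈ (0,1) there exists a unique Δ₀ ∈ (0, log(N/M) − overline{log N^M}) such that (1−θ)·Δ₀ = (1/θ − 1)·I(log(N/M) − Δ₀). -/
open Real
open scoped BigOperators

/-- The Cramér rate function of a uniform random variable on `{log N_1, …, log N_M}`. -/
noncomputable def rateI (M : ℕ) (Ncol : Fin M → ℕ) (x : ℝ) : ℝ :=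
  ⨆ l : ℝ, (l * x - Real.log ((1 / M) * ∑ j, (Ncol j : ℝ) ^ l))

/-- The Legendre transform of `K` is convex on every convex set where the supremum is finite. -/
theorem convexOn_legendre (K : ℝ → ℝ) {s : Set ℝ} (hs : Convex ℝ s)
    (hb : ∀ x ∈ s, BddAbove (Set.range fun l : ℝ => l * x - K l)) :
    ConvexOn ℝ s fun x => ⨆ l : ℝ, (l * x - K l) := by
  refine ⟨hs, fun x hx y hy p q hp hq hpq => ciSup_le fun l => ?_⟩
  have h1 := mul_le_mul_of_nonneg_left (le_ciSup (hb x hx) l) hp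
  have h2 := mul_le_mul_of_nonneg_left (le_ciSup (hb y hy) l) hq
  simp only [smul_eq_mul]
  have h3 : K l = p * K l + q * K l := by rw [← add_mul, hpq, one_mul]
  linarith

/-- A line of positive slope `θ` through the point `L`, read leftwards, meets the Legendre
transform of `K` exactly once between the zero `μ` of the transform and `L`. -/
theorem existsUnique_mul_eq_legendre (K : ℝ → ℝ) {a b μ L C l₀ θ : ℝ} (hK0 : K 0 = 0)
    (hμ : ∀ l, l * μ ≤ K l) (hb : ∀ l, 0 ≤ l → l * b - C ≤ K l)
    (ha : ∀ l, l ≤ 0 → l * a - C ≤ K l) (haμ : a < μ) (hμL : μ < L) (hLb : L < b)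
    (hl₀ : K l₀ < l₀ * L) (hθ : 0 < θ) :
    ∃! Δ : ℝ, Δ ∈ Set.Ioo 0 (L - μ) ∧ θ * Δ = ⨆ l : ℝ, (l * (L - Δ) - K l) := by
  have hbdd : ∀ x ∈ Set.Ioo a b, BddAbove (Set.range fun l : ℝ => l * x - K l) := by
    rintro x ⟨hax, hxb⟩
    refine ⟨C, ?_⟩
    rintro _ ⟨l, rfl⟩
    rcases le_total 0 l with hl | hl
    · have := mul_le_mul_of_nonneg_left hxb.le hl
      linarith [hb l hl]
    · have := mul_le_mul_of_nonpos_left hax.le hl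
      linarith [ha l hl]
  set I : ℝ → ℝ := fun x => ⨆ l : ℝ, (l * x - K l) with hI
  have hle : ∀ x ∈ Set.Ioo a b, ∀ l, l * x - K l ≤ I x := fun x hx l => le_ciSup (hbdd x hx) l
  have hcont : ContinuousOn I (Set.Ioo a b) :=
    (convexOn_legendre K (convex_Ioo a b) hbdd).continuousOn isOpen_Ioo
  have hmono : ∀ x y, μ ≤ x → x ≤ y → y < b → I x ≤ I y := by
    intro x y hμx hxy hyb
    have hy : y ∈ Set.Ioo a b := ⟨by linarith, hyb⟩
    refine ciSup_le fun l => ?_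
    rcases le_total 0 l with hl | hl
    · have := mul_le_mul_of_nonneg_left hxy hl
      linarith [hle y hy l]
    · have := mul_le_mul_of_nonpos_left hμx hl
      linarith [hle y hy 0, hμ l]
  have hIμ : I μ ≤ 0 := ciSup_le fun l => by linarith [hμ l]
  have hIL : 0 < I L := by linarith [hle L ⟨by linarith, hLb⟩ l₀]
  have hanti : ∀ u v, 0 ≤ u → u < v → v ≤ L - μ → I (L - v) - θ * v < I (L - u) - θ * u := by
    intro u v hu huv hv
    have := hmono (L - v) (L - u) (by linarith) (by linarith) (by linarith)
    have := mul_lt_mul_of_pos_left huv hθ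
    linarith
  have hcont' : ContinuousOn (fun Δ => I (L - Δ) - θ * Δ) (Set.Icc 0 (L - μ)) := by
    refine ContinuousOn.sub (hcont.comp (by fun_prop) ?_) (by fun_prop)
    rintro x ⟨h0, h1⟩
    exact ⟨by linarith, by linarith⟩
  have hD : 0 < θ * (L - μ) := mul_pos hθ (by linarith)
  obtain ⟨Δ, hΔ, hΔ0⟩ := intermediate_value_Ioo' (by linarith : (0 : ℝ) ≤ L - μ) hcont'
    (show (0 : ℝ) ∈ Set.Ioo _ _ from
      ⟨by simp only [sub_sub_cancel]; linarith, by simpa using hIL⟩)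
  refine ⟨Δ, ⟨hΔ, by simp only at hΔ0; change θ * Δ = I (L - Δ); linarith⟩, ?_⟩
  rintro v ⟨hv, hv0⟩
  change θ * v = I (L - v) at hv0
  simp only at hΔ0
  rcases lt_trichotomy v Δ with h | h | h
  · linarith [hanti v Δ hv.1.le h hΔ.2.le]
  · exact h
  · linarith [hanti Δ v hΔ.1.le h hv.2.le]

theorem exists_unique_Delta0
    (M : ℕ) (hM : 2 ≤ M) (Ncol : Fin M → ℕ) (hpos : ∀ j, 0 < Ncol j)
    (hnonunif : ∃ j j' : Fin M, Ncol j ≠ Ncol j')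
    (N : ℕ) (hN : N = ∑ j, Ncol j)
    (θ : ℝ) (hθ : θ ∈ Set.Ioo (0 : ℝ) 1) :
    ∃! Δ₀ : ℝ,
      Δ₀ ∈ Set.Ioo 0 (Real.log ((N : ℝ) / M) - (1 / M) * ∑ j, Real.log (Ncol j)) ∧
      (1 - θ) * Δ₀ = (1 / θ - 1) * rateI M Ncol (Real.log ((N : ℝ) / M) - Δ₀) := by
  obtain ⟨hθ0, hθ1⟩ := hθ
  obtain ⟨j₁, j₂, hj⟩ := hnonunif
  have hM0 : (0 : ℝ) < M := by exact_mod_cast (by omega : 0 < M)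
  have hn : ∀ j, (0 : ℝ) < Ncol j := fun j => by exact_mod_cast hpos j
  have hN' : (N : ℝ) = ∑ j, (Ncol j : ℝ) := by rw [hN]; push_cast; rfl
  have hw : ∑ _j : Fin M, (1 / M : ℝ) = 1 := by simp [hM0.ne']
  set μ : ℝ := (1 / M) * ∑ j, Real.log (Ncol j) with hμdef
  set L : ℝ := Real.log ((N : ℝ) / M) with hLdef
  set K : ℝ → ℝ := fun l => Real.log ((1 / M) * ∑ j, (Ncol j : ℝ) ^ l) with hK
  have hne : (Finset.univ : Finset (Fin M)).Nonempty := ⟨j₁, Finset.mem_univ _⟩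
  have hNpos : (0 : ℝ) < N := by rw [hN']; exact Finset.sum_pos (fun j _ => hn j) hne
  have hK0 : K 0 = 0 := by simp [hK, hM0.ne']
  have hsum : ∀ l : ℝ, 0 < ∑ j, (Ncol j : ℝ) ^ l := fun l =>
    Finset.sum_pos (fun j _ => Real.rpow_pos_of_pos (hn j) l) hne
  have hterm : ∀ (j : Fin M) (l : ℝ), l * Real.log (Ncol j) - Real.log M ≤ K l := by
    intro j l
    rw [← Real.log_rpow (hn j), ← Real.log_div (Real.rpow_pos_of_pos (hn j) l).ne' hM0.ne']
    refine Real.log_le_log (div_pos (Real.rpow_pos_of_pos (hn j) l) hM0) ?_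
    rw [div_eq_inv_mul, one_div]
    exact mul_le_mul_of_nonneg_left (Finset.single_le_sum
      (f := fun j => (Ncol j : ℝ) ^ l) (fun i _ => (Real.rpow_pos_of_pos (hn i) l).le)
      (Finset.mem_univ j)) (inv_pos.2 hM0).le
  have hμ : ∀ l, l * μ ≤ K l := by
    intro l
    have := strictConcaveOn_log_Ioi.concaveOn.le_map_sum (t := Finset.univ)
      (w := fun _ : Fin M => (1 / M : ℝ)) (p := fun j => (Ncol j : ℝ) ^ l)
      (fun _ _ => by positivity) hw (fun j _ => Real.rpow_pos_of_pos (hn j) l)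
    simp only [smul_eq_mul, ← Finset.mul_sum, Real.log_rpow (hn _)] at this
    linarith
  have hl₀ : K (1 / 2) < 1 / 2 * L := by
    have := Real.strictConcaveOn_sqrt.lt_map_sum (t := Finset.univ)
      (w := fun _ : Fin M => (1 / M : ℝ)) (p := fun j => (Ncol j : ℝ))
      (fun _ _ => by positivity) hw (fun j _ => (hn j).le)
      ⟨j₁, Finset.mem_univ _, j₂, Finset.mem_univ _, by exact_mod_cast hj⟩
    simp only [smul_eq_mul, ← Finset.mul_sum, Real.sqrt_eq_rpow, ← hN'] at this
    rw [one_div_mul_eq_div (M : ℝ) (N : ℝ)] at this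
    rw [hLdef, ← Real.log_rpow (div_pos hNpos hM0)]
    exact Real.log_lt_log (mul_pos (by positivity) (hsum _)) this
  have hμL : μ < L := by linarith [hμ (1 / 2)]
  obtain ⟨i, hi⟩ : ∃ i, Real.log (Ncol i) < μ := by
    by_contra! h
    have hz : ∀ j, Real.log (Ncol j) = μ := by
      have h0 : ∑ j, (Real.log (Ncol j) - μ) = 0 := by
        simp only [Finset.sum_sub_distrib, Finset.sum_const, Finset.card_univ, Fintype.card_fin,
          nsmul_eq_mul, hμdef]
        field_simp
        ring
      intro j
      have := (Finset.sum_eq_zero_iff_of_nonneg (fun j _ => sub_nonneg.2 (h j))).1 h0 j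
        (Finset.mem_univ j)
      linarith
    exact hj (by exact_mod_cast Real.log_injOn_pos (hn j₁) (hn j₂) ((hz j₁).trans (hz j₂).symm))
  obtain ⟨k, hk⟩ : ∃ k, L < Real.log (Ncol k) := by
    by_contra! h
    have hle : ∀ j, (Ncol j : ℝ) ≤ N / M := fun j =>
      (Real.log_le_log_iff (hn j) (div_pos hNpos hM0)).1 (h j)
    have hz : ∀ j, (Ncol j : ℝ) = N / M := by
      have h0 : ∑ j, ((N : ℝ) / M - Ncol j) = 0 := by
        simp only [Finset.sum_sub_distrib, Finset.sum_const, Finset.card_univ, Fintype.card_fin,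
          nsmul_eq_mul, ← hN']
        field_simp
        ring
      intro j
      have := (Finset.sum_eq_zero_iff_of_nonneg (fun j _ => sub_nonneg.2 (hle j))).1 h0 j
        (Finset.mem_univ j)
      linarith
    exact hj (by exact_mod_cast (hz j₁).trans (hz j₂).symm)
  have key := existsUnique_mul_eq_legendre K hK0 hμ (fun l _ => hterm k l) (fun l _ => hterm i l)
    hi hμL hk hl₀ hθ0
  have hiff : ∀ Δ r : ℝ, (1 - θ) * Δ = (1 / θ - 1) * r ↔ θ * Δ = r := by
    intro Δ r
    have h1 : 1 - θ ≠ 0 := by linarith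
    have h2 : (1 / θ - 1) * r = (1 - θ) * (r / θ) := by field_simp
    rw [h2, mul_right_inj' h1, eq_div_iff hθ0.ne', mul_comm]
  simpa only [hiff, rateI] using key
end

section
/- Let M ≥ 2 be an integer and N_1,…,N_M positive integers that are not all equal, with N := N_1+…+N_M. The equation Δ = I(log(N/M) − Δ) has a unique solution Δ₀(1) in the interval (0, log(N/M) − overline{log N^M}); in particular Δ₀(1) > 0. Moreover, writing Δ₀(θ) for the unique solution in (0, log(N/M) − overline{log N^M}) of (1−θ)·Δ = (1/θ − 1)·I(log(N/M) − Δ) for θ ∈ (0,1), one has Δ₀(θ) → Δ₀(1) as θ → 1⁻. -/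
open Real Filter
open scoped BigOperators Topology

/-- The uniform log-moment dominates `l * log N_j` up to the constant `log M`. -/
lemma mul_log_sub_log_mean_le {M : ℕ} {Ncol : Fin M → ℕ} (hpos : ∀ j, 0 < Ncol j)
    (l : ℝ) (j : Fin M) :
    l * Real.log (Ncol j) - Real.log M ≤
      Real.log ((1 / M) * ∑ j, (Ncol j : ℝ) ^ l) := by
  have hM : (0 : ℝ) < M := by exact_mod_cast j.pos
  have hp : ∀ i, (0 : ℝ) < Ncol i := fun i => by exact_mod_cast hpos i
  have hle : (Ncol j : ℝ) ^ l ≤ ∑ i, (Ncol i : ℝ) ^ l :=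
    Finset.single_le_sum (f := fun i => (Ncol i : ℝ) ^ l)
      (fun i _ => (Real.rpow_pos_of_pos (hp i) l).le) (Finset.mem_univ j)
  have hjl := Real.rpow_pos_of_pos (hp j) l
  rw [Real.log_mul (by positivity) (hjl.trans_le hle).ne', one_div, Real.log_inv,
    ← Real.log_rpow (hp j)]
  linarith [Real.log_le_log hjl hle]

lemma bddAbove_range_rateI {M : ℕ} {Ncol : Fin M → ℕ} (hpos : ∀ j, 0 < Ncol j)
    {i k : Fin M} {x : ℝ} (hx : x ∈ Set.Icc (Real.log (Ncol i)) (Real.log (Ncol k))) :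
    BddAbove (Set.range fun l : ℝ =>
      l * x - Real.log ((1 / M) * ∑ j, (Ncol j : ℝ) ^ l)) := by
  refine ⟨Real.log M, ?_⟩
  rintro _ ⟨l, rfl⟩
  have hi := mul_log_sub_log_mean_le hpos l i
  have hk := mul_log_sub_log_mean_le hpos l k
  rcases le_total 0 l with h | h
  · have := mul_le_mul_of_nonneg_left hx.2 h
    dsimp only
    linarith
  · have := mul_le_mul_of_nonpos_left hx.1 h
    dsimp only
    linarith

lemma convexOn_rateI {M : ℕ} {Ncol : Fin M → ℕ} (hpos : ∀ j, 0 < Ncol j) (i k : Fin M) :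
    ConvexOn ℝ (Set.Icc (Real.log (Ncol i)) (Real.log (Ncol k))) (rateI M Ncol) := by
  refine ⟨convex_Icc _ _, fun x hx y hy a b ha hb hab => ?_⟩
  refine ciSup_le fun l => ?_
  have h1 := le_ciSup (bddAbove_range_rateI hpos hx) l
  have h2 := le_ciSup (bddAbove_range_rateI hpos hy) l
  have h3 := mul_le_mul_of_nonneg_left h1 ha
  have h4 := mul_le_mul_of_nonneg_left h2 hb
  simp only [smul_eq_mul]
  unfold rateI
  refine le_trans (le_of_eq ?_) (add_le_add h3 h4)
  linear_combination Real.log ((1 / M) * ∑ j, (Ncol j : ℝ) ^ l) * hab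

/-- The rate function vanishes at the mean of the logarithms. -/
lemma rateI_mean_log {M : ℕ} (hM : 0 < M) {Ncol : Fin M → ℕ} (hpos : ∀ j, 0 < Ncol j) :
    rateI M Ncol ((1 / M) * ∑ j, Real.log (Ncol j)) = 0 := by
  have hM' : (0 : ℝ) < M := by exact_mod_cast hM
  have hp : ∀ i, (0 : ℝ) < Ncol i := fun i => by exact_mod_cast hpos i
  have hle : ∀ l : ℝ, l * ((1 / M) * ∑ j, Real.log (Ncol j)) -
      Real.log ((1 / M) * ∑ j, (Ncol j : ℝ) ^ l) ≤ 0 := by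
    intro l
    have h := strictConcaveOn_log_Ioi.concaveOn.le_map_sum (t := Finset.univ)
      (w := fun _ : Fin M => 1 / (M : ℝ)) (p := fun j => (Ncol j : ℝ) ^ l)
      (fun _ _ => by positivity) (by simp [hM'.ne'])
      (fun j _ => Real.rpow_pos_of_pos (hp j) l)
    simp only [smul_eq_mul, ← Finset.mul_sum] at h
    simp only [Real.log_rpow (hp _), ← Finset.mul_sum] at h
    linarith
  refine le_antisymm (ciSup_le hle) ?_
  refine le_trans (le_of_eq ?_) (le_ciSup (f := fun l : ℝ =>
    l * ((1 / M) * ∑ j, Real.log (Ncol j)) -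
      Real.log ((1 / M) * ∑ j, (Ncol j : ℝ) ^ l)) ⟨0, ?_⟩ 0)
  · simp [hM'.ne']
  · rintro _ ⟨l, rfl⟩
    exact hle l

/-- The mean of a function on `Fin M` lies strictly above a lower bound that is not
attained everywhere. -/
lemma lt_mean_of_le {M : ℕ} {f : Fin M → ℝ} {c : ℝ} (h : ∀ j, c ≤ f j) (k : Fin M)
    (hk : c < f k) : c < (1 / M) * ∑ j, f j := by
  have hM : (0 : ℝ) < M := by exact_mod_cast k.pos
  have := Finset.sum_lt_sum (fun j _ => h j) ⟨k, Finset.mem_univ k, hk⟩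
  simp only [Finset.sum_const, Finset.card_univ, Fintype.card_fin, nsmul_eq_mul] at this
  rw [one_div, lt_inv_mul_iff₀ hM]
  exact this

lemma mean_lt_of_le {M : ℕ} {f : Fin M → ℝ} {c : ℝ} (h : ∀ j, f j ≤ c) (k : Fin M)
    (hk : f k < c) : (1 / M) * ∑ j, f j < c := by
  have := lt_mean_of_le (f := fun j => -f j) (fun j => neg_le_neg (h j)) k (neg_lt_neg hk)
  rw [Finset.sum_neg_distrib] at this
  linarith

/-- The rate function is positive at the logarithm of the mean. -/
lemma rateI_log_mean_pos {M : ℕ} {Ncol : Fin M → ℕ} (hpos : ∀ j, 0 < Ncol j)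
    (hne : ∃ j j' : Fin M, Ncol j ≠ Ncol j') {i k : Fin M}
    (hx : Real.log ((1 / M) * ∑ j, (Ncol j : ℝ)) ∈
      Set.Icc (Real.log (Ncol i)) (Real.log (Ncol k))) :
    0 < rateI M Ncol (Real.log ((1 / M) * ∑ j, (Ncol j : ℝ))) := by
  have hM : (0 : ℝ) < M := by exact_mod_cast i.pos
  have hp : ∀ i, (0 : ℝ) < Ncol i := fun i => by exact_mod_cast hpos i
  have : Nonempty (Fin M) := ⟨i⟩
  refine lt_of_lt_of_le ?_ (le_ciSup (bddAbove_range_rateI hpos hx) (1 / 2))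
  obtain ⟨j, j', hjj⟩ := hne
  have h := Real.strictConcaveOn_sqrt.lt_map_sum (t := Finset.univ)
    (w := fun _ : Fin M => 1 / (M : ℝ)) (p := fun j => (Ncol j : ℝ))
    (fun _ _ => by positivity) (by simp [hM.ne']) (fun j _ => (hp j).le)
    ⟨j, Finset.mem_univ j, j', Finset.mem_univ j', by exact_mod_cast hjj⟩
  simp only [smul_eq_mul, ← Finset.mul_sum] at h
  have hs : 0 < ∑ j, √(Ncol j : ℝ) :=
    Finset.sum_pos (fun j _ => Real.sqrt_pos.2 (hp j)) Finset.univ_nonempty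
  have hs' : 0 < ∑ j, (Ncol j : ℝ) :=
    Finset.sum_pos (fun j _ => hp j) Finset.univ_nonempty
  have hlog := Real.log_lt_log (by positivity) h
  rw [Real.log_sqrt (by positivity)] at hlog
  simp only [← Real.sqrt_eq_rpow]
  linarith

theorem Delta0_at_one_and_left_limit
    (M : ℕ) (hM : 2 ≤ M) (Ncol : Fin M → ℕ) (hpos : ∀ j, 0 < Ncol j)
    (hnonunif : ∃ j j' : Fin M, Ncol j ≠ Ncol j')
    (N : ℕ) (hN : N = ∑ j, Ncol j) :
    (∃! Δ : ℝ,
        Δ ∈ Set.Ioo 0 (Real.log ((N : ℝ) / M) - (1 / M) * ∑ j, Real.log (Ncol j)) ∧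
        Δ = rateI M Ncol (Real.log ((N : ℝ) / M) - Δ)) ∧
    ∀ Δ₁ : ℝ,
      (Δ₁ ∈ Set.Ioo 0 (Real.log ((N : ℝ) / M) - (1 / M) * ∑ j, Real.log (Ncol j)) ∧
        Δ₁ = rateI M Ncol (Real.log ((N : ℝ) / M) - Δ₁)) →
      0 < Δ₁ ∧
      ∀ D : ℝ → ℝ,
        (∀ θ ∈ Set.Ioo (0 : ℝ) 1,
          D θ ∈ Set.Ioo 0 (Real.log ((N : ℝ) / M) - (1 / M) * ∑ j, Real.log (Ncol j)) ∧
          (1 - θ) * D θ = (1 / θ - 1) * rateI M Ncol (Real.log ((N : ℝ) / M) - D θ)) →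
        Tendsto D (nhdsWithin 1 (Set.Iio 1)) (nhds Δ₁) := by
  have hM0 : 0 < M := by omega
  have hM' : (0 : ℝ) < M := by exact_mod_cast hM0
  have hp : ∀ i, (0 : ℝ) < Ncol i := fun i => by exact_mod_cast hpos i
  have : Nonempty (Fin M) := ⟨⟨0, hM0⟩⟩
  have hNM : (N : ℝ) / M = (1 / M) * ∑ j, (Ncol j : ℝ) := by
    rw [hN]; push_cast; ring
  rw [hNM]
  obtain ⟨i, hi⟩ := Finite.exists_min Ncol
  obtain ⟨k, hk⟩ := Finite.exists_max Ncol
  obtain ⟨j, j', hjj⟩ := hnonunif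
  have hik : Ncol i < Ncol k := by
    have := hi j; have := hi j'; have := hk j; have := hk j'
    omega
  have hik' : (Ncol i : ℝ) < Ncol k := by exact_mod_cast hik
  have hlogik := Real.log_lt_log (hp i) hik'
  set m := (1 / (M : ℝ)) * ∑ j, Real.log (Ncol j) with hm
  set A := (1 / (M : ℝ)) * ∑ j, (Ncol j : ℝ) with hA
  have hmi : Real.log (Ncol i) < m :=
    lt_mean_of_le (fun j => Real.log_le_log (hp i) (by exact_mod_cast hi j)) k hlogik
  have hAi : (Ncol i : ℝ) < A := lt_mean_of_le (fun j => by exact_mod_cast hi j) k hik'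
  have hAk : A < Ncol k := mean_lt_of_le (fun j => by exact_mod_cast hk j) i hik'
  have hak : Real.log A < Real.log (Ncol k) := Real.log_lt_log ((hp i).trans hAi) hAk
  have hai : Real.log (Ncol i) < Real.log A := Real.log_lt_log (hp i) hAi
  have hma : m < Real.log A := by
    have h := strictConcaveOn_log_Ioi.lt_map_sum (t := Finset.univ)
      (w := fun _ : Fin M => 1 / (M : ℝ)) (p := fun j => (Ncol j : ℝ))
      (fun _ _ => by positivity) (by simp [hM'.ne']) (fun j _ => hp j)
      ⟨j, Finset.mem_univ j, j', Finset.mem_univ j', by exact_mod_cast hjj⟩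
    simpa only [smul_eq_mul, ← Finset.mul_sum] using h
  have hIm : rateI M Ncol m = 0 := rateI_mean_log hM0 hpos
  have hIa : 0 < rateI M Ncol (Real.log A) :=
    rateI_log_mean_pos hpos ⟨j, j', hjj⟩ ⟨hai.le, hak.le⟩
  have hconv := convexOn_rateI hpos i k
  have hcont : ContinuousOn (rateI M Ncol) (Set.Ioo (Real.log (Ncol i)) (Real.log (Ncol k))) :=
    (hconv.subset Set.Ioo_subset_Icc_self (convex_Ioo _ _)).continuousOn isOpen_Ioo
  have hnonneg : ∀ x ∈ Set.Icc m (Real.log A), 0 ≤ rateI M Ncol x := by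
    intro x hx
    refine le_trans (le_of_eq ?_) (le_ciSup (bddAbove_range_rateI hpos
      (⟨hmi.le.trans hx.1, hx.2.trans hak.le⟩ :
        x ∈ Set.Icc (Real.log (Ncol i)) (Real.log (Ncol k)))) 0)
    simp [hM'.ne']
  have hmono : MonotoneOn (rateI M Ncol) (Set.Icc m (Real.log A)) := by
    intro x hx y hy hxy
    have h := hconv.le_max_of_mem_Icc (x := m) (y := y) (z := x)
      ⟨hmi.le, (hma.trans hak).le⟩ ⟨hmi.le.trans hy.1, hy.2.trans hak.le⟩ ⟨hx.1, hxy⟩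
    rwa [hIm, max_eq_right (hnonneg y hy)] at h
  set a := Real.log A with ha
  have hanti : ∀ x y, 0 < x → x ≤ y → y < a - m →
      rateI M Ncol (a - y) ≤ rateI M Ncol (a - x) := fun x y hx hxy hy =>
    hmono ⟨by linarith, by linarith⟩ ⟨by linarith, by linarith⟩ (by linarith)
  refine ⟨?_, ?_⟩
  · have hg : ContinuousOn (fun x => rateI M Ncol (a - x) - x) (Set.Icc 0 (a - m)) := by
      refine ContinuousOn.sub (hcont.comp (by fun_prop) fun x hx => ?_) continuousOn_id
      exact ⟨by linarith [hx.2], by linarith [hx.1]⟩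
    obtain ⟨x, hx, hx0⟩ := intermediate_value_Ioo' (by linarith : (0 : ℝ) ≤ a - m) hg
      (show (0 : ℝ) ∈ _ from ⟨by simp [hIm, hma], by simpa using hIa⟩)
    have hx0 : rateI M Ncol (a - x) - x = 0 := hx0
    refine ⟨x, ⟨hx, by linarith⟩, ?_⟩
    rintro y ⟨hy, hy0⟩
    rcases le_total x y with h | h
    · linarith [hanti x y hx.1 h hy.2]
    · linarith [hanti y x hy.1 h hx.2]
  · rintro x ⟨hx, hx0⟩
    refine ⟨hx.1, fun D hD => ?_⟩
    have key : ∀ θ ∈ Set.Ioo (0 : ℝ) 1, x ≤ D θ ∧ D θ ≤ x / θ := by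
      intro θ hθ
      obtain ⟨hy, he⟩ := hD θ hθ
      have hθ0 := hθ.1
      have heq : θ * D θ = rateI M Ncol (a - D θ) := by
        have h1 : (1 - θ) ≠ 0 := by linarith [hθ.2]
        have : 1 / θ - 1 = (1 - θ) / θ := by field_simp
        rw [this] at he
        field_simp at he
        exact he
      have hlt : θ * D θ < D θ := by nlinarith [hθ.2, hy.1]
      have hle : x ≤ D θ := by
        by_contra! h
        linarith [hanti (D θ) x hy.1 h.le hx.2]
      refine ⟨hle, ?_⟩
      rw [le_div_iff₀ hθ0]
      linarith [hanti x (D θ) hx.1 hle hy.2]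
    have hev : ∀ᶠ θ in nhdsWithin (1 : ℝ) (Set.Iio 1), θ ∈ Set.Ioo (0 : ℝ) 1 :=
      Ioo_mem_nhdsLT one_pos
    have hlim : Tendsto (fun θ : ℝ => x / θ) (nhdsWithin 1 (Set.Iio 1)) (nhds x) := by
      have : ContinuousAt (fun θ : ℝ => x / θ) 1 :=
        continuousAt_const.div continuousAt_id one_ne_zero
      simpa using this.tendsto.mono_left nhdsWithin_le_nhds
    exact tendsto_of_tendsto_of_tendsto_of_le_of_le' tendsto_const_nhds hlim
      (hev.mono fun θ h => (key θ h).1) (hev.mono fun θ h => (key θ h).2)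
end

section
/- Let θ ∈ [log m/log n, 1) and Δ₀ ∈ (0, log(N/M) − overline{log N^M}). If s > log M/log m + log(N/M)/log n − Δ₀·(1−θ)/log n, then ∑_{B ∈ Good_K} M^{K/θ − K} · (∏_{ℓ=L(K)+1}^{L(K/θ)} N_{î_ℓ(B)}) · m^{−sK/θ} → 0 as K → ∞, where î_ℓ(B) denotes the ℓ-th column entry of the approximate square B. -/
open Real Filter
open scoped BigOperators Topology

/-- `L(k) = ⌊k · log m / log n⌋`. -/
noncomputable def Lfun (m n : ℕ) (x : ℝ) : ℕ := ⌊x * Real.log m / Real.log n⌋₊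

theorem card_padded_le {α β : Type*} [Fintype α] [Fintype β] (L K : ℕ) (a : α) (b : β)
    (p : (ℕ → α) × (ℕ → β) → Prop)
    (hp : ∀ x, p x → (∀ ℓ, L ≤ ℓ → x.1 ℓ = a) ∧ ∀ ℓ, ℓ < L ∨ K ≤ ℓ → x.2 ℓ = b) :
    Finite {x // p x} ∧
      Nat.card {x // p x} ≤ Fintype.card α ^ L * Fintype.card β ^ (K - L) := by
  let f : {x // p x} → (Fin L → α) × (Fin (K - L) → β) :=
    fun x => (fun i => x.1.1 i, fun i => x.1.2 (L + i))
  have hf : Function.Injective f := by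
    rintro ⟨x, hx⟩ ⟨y, hy⟩ hxy
    obtain ⟨hx1, hx2⟩ := hp x hx
    obtain ⟨hy1, hy2⟩ := hp y hy
    have h1 := congrArg Prod.fst hxy
    have h2 := congrArg Prod.snd hxy
    refine Subtype.ext (Prod.ext (funext fun ℓ => ?_) (funext fun ℓ => ?_))
    · by_cases hℓ : ℓ < L
      · exact congrFun h1 ⟨ℓ, hℓ⟩
      · exact (hx1 ℓ (not_lt.mp hℓ)).trans (hy1 ℓ (not_lt.mp hℓ)).symm
    · by_cases hℓ : ℓ < L ∨ K ≤ ℓ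
      · exact (hx2 ℓ hℓ).trans (hy2 ℓ hℓ).symm
      · push Not at hℓ
        have h := congrFun h2 ⟨ℓ - L, by omega⟩
        simpa [f, Nat.add_sub_cancel' hℓ.1] using h
  refine ⟨Finite.of_injective f hf, (Nat.card_le_card_of_injective f hf).trans ?_⟩
  simp [Nat.card_eq_fintype_card]

theorem Lfun_le {m n : ℕ} {x : ℝ} (hx : 0 ≤ x) :
    (Lfun m n x : ℝ) ≤ x * Real.log m / Real.log n :=
  Nat.floor_le (by have := Real.log_natCast_nonneg m; have := Real.log_natCast_nonneg n; positivity)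

theorem Lfun_mono {m n : ℕ} {x y : ℝ} (hxy : x ≤ y) : Lfun m n x ≤ Lfun m n y := by
  have := Real.log_natCast_nonneg m
  have := Real.log_natCast_nonneg n
  unfold Lfun
  gcongr

theorem prod_le_exp_of_average_log_le {ι : Type*} (f : ι → ℕ) (hf : ∀ i, 0 < f i) (x : ℕ → ι)
    {a b : ℕ} (hab : a ≤ b) {c : ℝ}
    (h : (1 / ((b : ℝ) - a)) * ∑ ℓ ∈ Finset.Ico a b, Real.log (f (x ℓ)) ≤ c) :
    ∏ ℓ ∈ Finset.Ico a b, (f (x ℓ) : ℝ) ≤ Real.exp (((b : ℝ) - a) * c) := by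
  have hpos : ∀ ℓ, (0 : ℝ) < f (x ℓ) := fun ℓ => by exact_mod_cast hf _
  rw [← Real.log_le_iff_le_exp (Finset.prod_pos fun ℓ _ => hpos ℓ),
    Real.log_prod fun ℓ _ => (hpos ℓ).ne']
  rcases hab.eq_or_lt with rfl | hlt
  · simp
  · have hba : (0 : ℝ) < (b : ℝ) - a := by
      rw [sub_pos]
      exact_mod_cast hlt
    rwa [one_div, inv_mul_le_iff₀ hba] at h

theorem good_squares_cover_cost_tendsto_zero
    (m n : ℕ) (hm : 2 ≤ m) (hmn : m < n)
    (M : ℕ) (hM : 2 ≤ M) (Ncol : Fin M → ℕ) (hpos : ∀ j, 0 < Ncol j)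
    (hnonunif : ∃ j j' : Fin M, Ncol j ≠ Ncol j')
    (N : ℕ) (hN : N = ∑ j, Ncol j)
    (φ : Fin N → Fin M) (hφ : ∀ j, (Finset.univ.filter (fun i => φ i = j)).card = Ncol j)
    (θ : ℝ) (hθ1 : Real.log m / Real.log n ≤ θ) (hθ2 : θ < 1)
    (Δ₀ : ℝ)
    (hΔ₀ : Δ₀ ∈ Set.Ioo 0 (Real.log ((N : ℝ) / M) - (1 / M) * ∑ j, Real.log (Ncol j)))
    -- padding values used to represent tuples by total functions on `ℕ`
    (d₁ : Fin N) (d₂ : Fin M)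
    (s : ℝ)
    (hs : s > Real.log M / Real.log m + Real.log ((N : ℝ) / M) / Real.log n
        - Δ₀ * (1 - θ) / Real.log n) :
    Tendsto (fun K : ℕ =>
      -- sum over `Good_K` of `M^(K/θ-K) · ∏ N_{î_ℓ} · m^(-sK/θ)`:
      ∑' B : {x : (ℕ → Fin N) × (ℕ → Fin M) //
          (∀ ℓ, Lfun m n (K : ℝ) ≤ ℓ → x.1 ℓ = d₁) ∧
          (∀ ℓ, ℓ < Lfun m n (K : ℝ) ∨ K ≤ ℓ → x.2 ℓ = d₂) ∧
          (1 / ((Lfun m n ((K : ℝ) / θ) : ℝ) - (Lfun m n (K : ℝ) : ℝ))) *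
              ∑ ℓ ∈ Finset.Ico (Lfun m n (K : ℝ)) (Lfun m n ((K : ℝ) / θ)),
                Real.log (Ncol (x.2 ℓ))
            ≤ Real.log ((N : ℝ) / M) - Δ₀},
        (M : ℝ) ^ ((K : ℝ) / θ - (K : ℝ)) *
          (∏ ℓ ∈ Finset.Ico (Lfun m n (K : ℝ)) (Lfun m n ((K : ℝ) / θ)),
            (Ncol (B.1.2 ℓ) : ℝ)) *
          (m : ℝ) ^ (-(s * (K : ℝ) / θ)))
      atTop (nhds 0) := by
  obtain ⟨hΔ, hΔlt⟩ := hΔ₀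
  have hlm : 0 < Real.log m := Real.log_pos (by exact_mod_cast hm)
  have hln : 0 < Real.log n := Real.log_pos (by exact_mod_cast (by omega : 1 < n))
  have hθ : 0 < θ := (div_pos hlm hln).trans_le hθ1
  have hMpos : (0 : ℝ) < M := by positivity
  have hNpos : (0 : ℝ) < N := by exact_mod_cast d₁.pos
  have hmpos : (0 : ℝ) < m := by positivity
  have hc : 0 ≤ Real.log ((N : ℝ) / M) - Δ₀ := by
    have : 0 ≤ (1 / (M : ℝ)) * ∑ j, Real.log (Ncol j) :=
      mul_nonneg (by positivity) (Finset.sum_nonneg fun j _ => Real.log_natCast_nonneg _)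
    linarith
  set A : ℝ := Real.log ((N : ℝ) / M) with hA
  have hlogN : Real.log N = A + Real.log M := by
    rw [hA, Real.log_div hNpos.ne' hMpos.ne', sub_add_cancel]
  set δ : ℝ := Real.log m / θ *
    (s - (Real.log M / Real.log m + A / Real.log n - Δ₀ * (1 - θ) / Real.log n)) with hδ
  have hδpos : 0 < δ := mul_pos (div_pos hlm hθ) (sub_pos.mpr hs)
  have hlim : Tendsto (fun K : ℕ => Real.exp (-(δ * K))) atTop (nhds 0) :=
    Real.tendsto_exp_neg_atTop_nhds_zero.comp
      (tendsto_natCast_atTop_atTop.const_mul_atTop hδpos)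
  refine squeeze_zero (fun K => tsum_nonneg fun B => by positivity) (fun K => ?_) hlim
  have hKle : (K : ℝ) ≤ K / θ := by
    rw [le_div_iff₀ hθ]
    exact mul_le_of_le_one_right K.cast_nonneg hθ2.le
  have hLL : Lfun m n (K : ℝ) ≤ Lfun m n ((K : ℝ) / θ) := Lfun_mono hKle
  have hL := Lfun_le (m := m) (n := n) (x := K) K.cast_nonneg
  have hL' := Lfun_le (m := m) (n := n) (x := K / θ) (by positivity)
  set L := Lfun m n (K : ℝ)
  set L' := Lfun m n ((K : ℝ) / θ)
  have hLK : L ≤ K := by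
    have : (L : ℝ) ≤ K := hL.trans (by
      rw [mul_div_assoc]
      exact mul_le_of_le_one_right K.cast_nonneg (hθ1.trans hθ2.le))
    exact_mod_cast this
  obtain ⟨hfin, hcard⟩ := card_padded_le L K d₁ d₂
    (fun x : (ℕ → Fin N) × (ℕ → Fin M) =>
      (∀ ℓ, L ≤ ℓ → x.1 ℓ = d₁) ∧ (∀ ℓ, ℓ < L ∨ K ≤ ℓ → x.2 ℓ = d₂) ∧
        (1 / ((L' : ℝ) - (L : ℝ))) * ∑ ℓ ∈ Finset.Ico L L', Real.log (Ncol (x.2 ℓ)) ≤ A - Δ₀)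
    (fun x hx => ⟨hx.1, hx.2.1⟩)
  have := Fintype.ofFinite {x : (ℕ → Fin N) × (ℕ → Fin M) //
      (∀ ℓ, L ≤ ℓ → x.1 ℓ = d₁) ∧ (∀ ℓ, ℓ < L ∨ K ≤ ℓ → x.2 ℓ = d₂) ∧
        (1 / ((L' : ℝ) - (L : ℝ))) * ∑ ℓ ∈ Finset.Ico L L', Real.log (Ncol (x.2 ℓ)) ≤ A - Δ₀}
  rw [Nat.card_eq_fintype_card, Fintype.card_fin, Fintype.card_fin] at hcard
  have hcard' := (Nat.cast_le (α := ℝ)).mpr hcard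
  push_cast at hcard'
  rw [tsum_fintype]
  have hterm := fun B : {x : (ℕ → Fin N) × (ℕ → Fin M) //
      (∀ ℓ, L ≤ ℓ → x.1 ℓ = d₁) ∧ (∀ ℓ, ℓ < L ∨ K ≤ ℓ → x.2 ℓ = d₂) ∧
        (1 / ((L' : ℝ) - (L : ℝ))) * ∑ ℓ ∈ Finset.Ico L L', Real.log (Ncol (x.2 ℓ)) ≤ A - Δ₀} =>
    prod_le_exp_of_average_log_le Ncol hpos B.1.2 hLL B.2.2.2
  calc
    _ ≤ _ := Finset.sum_le_card_nsmul _ _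
      ((M : ℝ) ^ ((K : ℝ) / θ - (K : ℝ)) * Real.exp (((L' : ℝ) - L) * (A - Δ₀)) *
        (m : ℝ) ^ (-(s * (K : ℝ) / θ))) fun B _ => by
          gcongr
          exact hterm B
    _ ≤ ((N : ℝ) ^ L * (M : ℝ) ^ (K - L)) *
        ((M : ℝ) ^ ((K : ℝ) / θ - (K : ℝ)) * Real.exp (((L' : ℝ) - L) * (A - Δ₀)) *
          (m : ℝ) ^ (-(s * (K : ℝ) / θ))) := by
      rw [nsmul_eq_mul, Finset.card_univ]
      gcongr
    _ = Real.exp (Real.log N * L + Real.log M * (K - L) + (Real.log M * (K / θ - K) +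
          (L' - L) * (A - Δ₀) + Real.log m * -(s * K / θ))) := by
      rw [← Real.rpow_natCast, ← Real.rpow_natCast, Nat.cast_sub hLK, Real.rpow_def_of_pos hNpos,
        Real.rpow_def_of_pos hMpos, Real.rpow_def_of_pos hMpos, Real.rpow_def_of_pos hmpos]
      simp only [Real.exp_add]
    _ ≤ Real.exp (-(δ * K)) := by
      rw [Real.exp_le_exp]
      calc
        _ = Real.log M * (K / θ) + L * Δ₀ + L' * (A - Δ₀) - Real.log m * (s * K / θ) := by
          rw [hlogN]
          ring
        _ ≤ Real.log M * (K / θ) + (K * Real.log m / Real.log n) * Δ₀ +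
            (K / θ * Real.log m / Real.log n) * (A - Δ₀) - Real.log m * (s * K / θ) := by
          gcongr
        _ = -(δ * K) := by
          rw [hδ]
          field_simp
          ring
end

section
/- Let M ≥ 2 be an integer, N_1,…,N_M positive integers that are not all equal, N := N_1+…+N_M, and φ : {1,…,N} → {1,…,M} a map with #φ⁻¹(ĵ) = N_ĵ for each ĵ; let n > m ≥ 2 be integers. For every t > 0 and every θ ∈ (0,1], H(P^t(θ)) > H(Q^t(θ)). -/
open Real
open scoped BigOperators

/-- The entropy of a probability vector. -/
noncomputable def entropy {k : ℕ} (p : Fin k → ℝ) : ℝ := -∑ i, p i * Real.log (p i)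

/-- Pointwise form of Gibbs' inequality. -/
lemma sub_lt_mul_log_sub_mul_log {p q : ℝ} (hp : 0 < p) (hq : 0 < q) (hne : q ≠ p) :
    q - p < q * Real.log q - q * Real.log p := by
  have h := Real.log_lt_sub_one_of_pos (div_pos hp hq)
    (fun h => hne ((div_eq_one_iff_eq hq.ne').1 h).symm)
  rw [Real.log_div hp.ne' hq.ne'] at h
  have h' := mul_lt_mul_of_pos_left h hq
  have e : q * (p / q - 1) = p - q := by field_simp
  linarith

lemma sub_le_mul_log_sub_mul_log {p q : ℝ} (hp : 0 < p) (hq : 0 < q) :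
    q - p ≤ q * Real.log q - q * Real.log p := by
  rcases eq_or_ne q p with rfl | hne
  · simp
  · exact (sub_lt_mul_log_sub_mul_log hp hq hne).le

/-- If `q` differs from `p` by moving mass towards the points where `log p` exceeds some
threshold `c`, then `q` has smaller entropy than `p`. -/
lemma entropy_lt_entropy_of_sub_mul_log_sub_nonneg {k : ℕ} {p q : Fin k → ℝ}
    (hp : ∀ i, 0 < p i) (hq : ∀ i, 0 < q i) (hsum : ∑ i, q i = ∑ i, p i) (c : ℝ)
    (h : ∀ i, 0 ≤ (q i - p i) * (Real.log (p i) - c)) (hne : ∃ i, q i ≠ p i) :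
    entropy q < entropy p := by
  have key : ∑ i, (1 + c) * (q i - p i) <
      ∑ i, (q i * Real.log (q i) - p i * Real.log (p i)) := by
    apply Finset.sum_lt_sum
    · intro i _
      linarith [h i, sub_le_mul_log_sub_mul_log (hp i) (hq i)]
    · obtain ⟨i, hi⟩ := hne
      exact ⟨i, Finset.mem_univ i, by
        linarith [h i, sub_lt_mul_log_sub_mul_log (hp i) (hq i) hi]⟩
  rw [← Finset.mul_sum, Finset.sum_sub_distrib, Finset.sum_sub_distrib, hsum, sub_self,
    mul_zero] at key
  unfold entropy
  linarith

/-- Mixing a weight that is antitone in `x` with the constant `1 / N` or with `1 / (M * x)`: the two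
mixtures differ with the same sign as the first one differs from its value at `N / M`. -/
lemma mixture_sub_mul_log_sub_nonneg {s Z β x M N : ℝ} (hs : 0 < s) (hs1 : s ≤ 1) (hZ : 0 < Z)
    (hβ : β ≤ 0) (hx : 0 < x) (hM : 0 < M) (hN : 0 < N) :
    0 ≤ (s * (1 / (M * x)) + (1 - s) * (x ^ β / Z) - (s * (1 / N) + (1 - s) * (x ^ β / Z))) *
      (Real.log (s * (1 / N) + (1 - s) * (x ^ β / Z)) -
        Real.log (s * (1 / N) + (1 - s) * ((N / M) ^ β / Z))) := by
  have hs' : 0 ≤ 1 - s := by linarith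
  have hpos : ∀ y : ℝ, 0 < y → 0 < s * (1 / N) + (1 - s) * (y ^ β / Z) := fun y hy => by
    positivity
  have hNM : 0 < N / M := by positivity
  rw [add_sub_add_right_eq_sub, ← mul_sub]
  rcases le_total x (N / M) with h | h
  · apply mul_nonneg
    · apply mul_nonneg hs.le
      rw [sub_nonneg]
      apply one_div_le_one_div_of_le (by positivity)
      rw [le_div_iff₀ hM] at h
      linarith
    · rw [sub_nonneg]
      apply Real.log_le_log (hpos _ hNM)
      have := Real.rpow_le_rpow_of_nonpos hx h hβ
      gcongr
  · apply mul_nonneg_of_nonpos_of_nonpos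
    · apply mul_nonpos_of_nonneg_of_nonpos hs.le
      rw [sub_nonpos]
      apply one_div_le_one_div_of_le hN
      rw [div_le_iff₀ hM] at h
      linarith
    · rw [sub_nonpos]
      apply Real.log_le_log (hpos _ hx)
      have := Real.rpow_le_rpow_of_nonpos hNM h hβ
      gcongr

theorem entropy_P_gt_entropy_Q
    (M : ℕ) (hM : 2 ≤ M) (Ncol : Fin M → ℕ) (hpos : ∀ j, 0 < Ncol j)
    (hnonunif : ∃ j j' : Fin M, Ncol j ≠ Ncol j')
    (N : ℕ) (hN : N = ∑ j, Ncol j)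
    (φ : Fin N → Fin M) (hφ : ∀ j, (Finset.univ.filter (fun i => φ i = j)).card = Ncol j)
    (m n : ℕ) (hm : 2 ≤ m) (hmn : m < n)
    (t : ℝ) (ht : 0 < t) (θ : ℝ) (hθ : θ ∈ Set.Ioc (0 : ℝ) 1) :
    entropy (fun i : Fin N => θ ^ t * (1 / (N : ℝ)) +
        (1 - θ ^ t) * ((Ncol (φ i) : ℝ) ^ (Real.log m / Real.log n - 1) /
          ∑ j, (Ncol j : ℝ) ^ (Real.log m / Real.log n))) >
      entropy (fun i : Fin N => θ ^ t * (1 / ((M : ℝ) * (Ncol (φ i) : ℝ))) +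
        (1 - θ ^ t) * ((Ncol (φ i) : ℝ) ^ (Real.log m / Real.log n - 1) /
          ∑ j, (Ncol j : ℝ) ^ (Real.log m / Real.log n))) := by
  obtain ⟨j₀, j₁, hj⟩ := hnonunif
  have hposR : ∀ j, (0 : ℝ) < Ncol j := fun j => by exact_mod_cast hpos j
  have hMR : (0 : ℝ) < M := by exact_mod_cast (by omega : 0 < M)
  have hNR : (0 : ℝ) < N := by
    rw [hN]
    push_cast
    exact Finset.sum_pos (fun j _ => hposR j) ⟨j₀, Finset.mem_univ _⟩
  have hZ : 0 < ∑ j, (Ncol j : ℝ) ^ (Real.log m / Real.log n) :=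
    Finset.sum_pos (fun j _ => Real.rpow_pos_of_pos (hposR j) _) ⟨j₀, Finset.mem_univ _⟩
  have hβ : Real.log m / Real.log n - 1 ≤ 0 := by
    have hn : 0 < Real.log n := Real.log_pos (by exact_mod_cast (by omega : 1 < n))
    rw [sub_nonpos, div_le_one hn]
    exact Real.log_le_log (by exact_mod_cast (by omega : 0 < m)) (by exact_mod_cast hmn.le)
  have hs : 0 < θ ^ t := Real.rpow_pos_of_pos hθ.1 t
  have hs1 : θ ^ t ≤ 1 := Real.rpow_le_one hθ.1.le hθ.2 ht.le
  have hs' : 0 ≤ 1 - θ ^ t := by linarith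
  have hp : ∀ i, 0 < (Ncol (φ i) : ℝ) ^ (Real.log m / Real.log n - 1) := fun i =>
    Real.rpow_pos_of_pos (hposR _) _
  have hsum : ∑ i : Fin N, 1 / ((M : ℝ) * Ncol (φ i)) = ∑ i : Fin N, 1 / (N : ℝ) := by
    rw [← Finset.sum_fiberwise Finset.univ φ]
    have : ∀ j, ∑ i with φ i = j, 1 / ((M : ℝ) * Ncol (φ i)) = 1 / M := fun j => by
      rw [Finset.sum_congr rfl (g := fun _ => 1 / ((M : ℝ) * Ncol j)) fun i hi => by
        rw [(Finset.mem_filter.1 hi).2]]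
      rw [Finset.sum_const, hφ, nsmul_eq_mul]
      have := (hposR j).ne'
      field_simp
    rw [Finset.sum_congr rfl fun j _ => this j]
    simp [hMR.ne', hNR.ne']
  apply entropy_lt_entropy_of_sub_mul_log_sub_nonneg
    (c := Real.log (θ ^ t * (1 / (N : ℝ)) +
      (1 - θ ^ t) * (((N : ℝ) / M) ^ (Real.log m / Real.log n - 1) /
        ∑ j, (Ncol j : ℝ) ^ (Real.log m / Real.log n))))
  · intro i
    have := hp i
    positivity
  · intro i
    have := hp i
    have := hposR (φ i)
    positivity
  · simp only [Finset.sum_add_distrib, ← Finset.mul_sum, hsum]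
  · exact fun i => mixture_sub_mul_log_sub_nonneg hs hs1 hZ hβ (hposR _) hMR hNR
  · by_contra! hall
    have hcol : ∀ j, (M : ℝ) * Ncol j = N := fun j => by
      obtain ⟨i, hi⟩ := Finset.card_pos.1 ((hφ j).symm ▸ hpos j)
      have h := mul_left_cancel₀ hs.ne' (add_right_cancel (hall i))
      rw [(Finset.mem_filter.1 hi).2] at h
      simpa only [one_div, inv_inj] using h
    exact hj (by exact_mod_cast mul_left_cancel₀ hMR.ne' ((hcol j₀).trans (hcol j₁).symm))
end

section
/- Let M ≥ 2 be an integer, N_1,…,N_M positive integers, N := N_1+…+N_M, φ : {1,…,N} → {1,…,M} a map with #φ⁻¹(ĵ) = N_ĵ for each ĵ, and n > m ≥ 2 integers. For every t > 0, the function θ ↦ ψ(t,θ) is differentiable at θ = 1, with derivative equal to (log(N/M) − overline{log N^M})/log n. -/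
open Real
open scoped BigOperators Topology

/-- Derivative at `θ = 1` of the entropy along the path from `p` to a positive vector `u`. -/
lemma hasDerivAt_entropy_mix {k : ℕ} (u p : Fin k → ℝ) (hu : ∀ i, 0 < u i) (t : ℝ) :
    HasDerivAt (fun θ : ℝ => entropy (fun i => θ ^ t * u i + (1 - θ ^ t) * p i))
      (-∑ i, t * (u i - p i) * (Real.log (u i) + 1)) 1 := by
  unfold entropy
  refine (HasDerivAt.fun_sum fun i _ => ?_).neg
  have hpow : HasDerivAt (fun θ : ℝ => θ ^ t) t 1 := by
    simpa using Real.hasDerivAt_rpow_const (x := 1) (p := t) (Or.inl one_ne_zero)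
  have hmix : HasDerivAt (fun θ : ℝ => θ ^ t * u i + (1 - θ ^ t) * p i) (t * (u i - p i)) 1 := by
    refine ((hpow.mul_const (u i)).add ((hpow.const_sub 1).mul_const (p i))).congr_deriv ?_
    ring
  have hval : (1 : ℝ) ^ t * u i + (1 - (1 : ℝ) ^ t) * p i = u i := by simp
  have hlog := hmix.log (by rw [hval]; exact (hu i).ne')
  refine (hmix.mul hlog).congr_deriv ?_
  rw [hval]
  have := (hu i).ne'
  field_simp

/-- The entropy is stationary at the uniform vector. -/
lemma hasDerivAt_entropy_mix_uniform {k : ℕ} (hk : 0 < k) (p : Fin k → ℝ) (hp : ∑ i, p i = 1)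
    (t : ℝ) :
    HasDerivAt (fun θ : ℝ => entropy (fun i => θ ^ t * (1 / (k : ℝ)) + (1 - θ ^ t) * p i)) 0 1 := by
  have hk' : (0 : ℝ) < k := by exact_mod_cast hk
  refine (hasDerivAt_entropy_mix (fun _ => 1 / (k : ℝ)) p (fun _ => by positivity) t).congr_deriv ?_
  rw [← Finset.sum_mul, ← Finset.mul_sum, Finset.sum_sub_distrib, hp]
  simp [hk'.ne']

lemma sum_comp_eq_sum_card_mul {N M : ℕ} (φ : Fin N → Fin M) (c : Fin M → ℕ)
    (hφ : ∀ j, (Finset.univ.filter (fun i => φ i = j)).card = c j) (f : Fin M → ℝ) :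
    ∑ i, f (φ i) = ∑ j, (c j : ℝ) * f j := by
  rw [← Finset.sum_fiberwise Finset.univ φ]
  refine Finset.sum_congr rfl fun j _ => ?_
  rw [Finset.sum_congr rfl (g := fun _ => f j)
    (fun i hi => by rw [(Finset.mem_filter.mp hi).2]), Finset.sum_const, hφ, nsmul_eq_mul]

lemma entropy_uniform {k : ℕ} (hk : 0 < k) : entropy (fun _ : Fin k => 1 / (k : ℝ)) = Real.log k := by
  have : (k : ℝ) ≠ 0 := by exact_mod_cast hk.ne'
  simp [entropy, this]

theorem psi_hasDerivAt_one
    (M : ℕ) (hM : 2 ≤ M) (Ncol : Fin M → ℕ) (hpos : ∀ j, 0 < Ncol j)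
    (N : ℕ) (hN : N = ∑ j, Ncol j)
    (φ : Fin N → Fin M) (hφ : ∀ j, (Finset.univ.filter (fun i => φ i = j)).card = Ncol j)
    (m n : ℕ) (hm : 2 ≤ m) (hmn : m < n)
    (t : ℝ) (ht : 0 < t) :
    HasDerivAt (fun θ : ℝ =>
        entropy (fun i : Fin N => θ ^ t * (1 / (N : ℝ)) +
            (1 - θ ^ t) * ((Ncol (φ i) : ℝ) ^ (Real.log m / Real.log n - 1) /
              ∑ j, (Ncol j : ℝ) ^ (Real.log m / Real.log n))) / Real.log n
        + (1 - Real.log m / Real.log n) *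
          entropy (fun j : Fin M => θ ^ t * (1 / (M : ℝ)) +
            (1 - θ ^ t) * ((Ncol j : ℝ) ^ (Real.log m / Real.log n) /
              ∑ j', (Ncol j' : ℝ) ^ (Real.log m / Real.log n))) / Real.log m
        - (1 - θ) *
          (entropy (fun i : Fin N => θ ^ t * (1 / (N : ℝ)) +
              (1 - θ ^ t) * ((Ncol (φ i) : ℝ) ^ (Real.log m / Real.log n - 1) /
                ∑ j, (Ncol j : ℝ) ^ (Real.log m / Real.log n)))
            - entropy (fun i : Fin N => θ ^ t * (1 / ((M : ℝ) * (Ncol (φ i) : ℝ))) +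
              (1 - θ ^ t) * ((Ncol (φ i) : ℝ) ^ (Real.log m / Real.log n - 1) /
                ∑ j, (Ncol j : ℝ) ^ (Real.log m / Real.log n)))) / Real.log n)
      ((Real.log ((N : ℝ) / M) - (1 / M) * ∑ j, Real.log (Ncol j)) / Real.log n) 1 := by
  have hM0 : 0 < M := by omega
  have hMR : (0 : ℝ) < M := by exact_mod_cast hM0
  have hc : ∀ j, (0 : ℝ) < Ncol j := fun j => by exact_mod_cast hpos j
  have hN0 : 0 < N := by
    rw [hN]
    exact Finset.sum_pos (fun j _ => hpos j) ⟨⟨0, hM0⟩, Finset.mem_univ _⟩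
  have hNR : (0 : ℝ) < N := by exact_mod_cast hN0
  set a : ℝ := Real.log m / Real.log n with ha
  set S : ℝ := ∑ j, (Ncol j : ℝ) ^ a with hS
  have hS0 : 0 < S :=
    Finset.sum_pos (fun j _ => Real.rpow_pos_of_pos (hc j) a) ⟨⟨0, hM0⟩, Finset.mem_univ _⟩
  have hq : ∑ j, (Ncol j : ℝ) ^ a / S = 1 := by
    rw [← Finset.sum_div, ← hS, div_self hS0.ne']
  have hp : ∑ i, (Ncol (φ i) : ℝ) ^ (a - 1) / S = 1 := by
    rw [sum_comp_eq_sum_card_mul φ Ncol hφ (fun j => (Ncol j : ℝ) ^ (a - 1) / S)]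
    refine Eq.trans ?_ hq
    refine Finset.sum_congr rfl fun j _ => ?_
    rw [Real.rpow_sub_one (hc j).ne']
    have := (hc j).ne'
    field_simp
  have hP := hasDerivAt_entropy_mix_uniform hN0 _ hp t
  have hQ := hasDerivAt_entropy_mix_uniform hM0 _ hq t
  have hR := hasDerivAt_entropy_mix (fun i => 1 / ((M : ℝ) * (Ncol (φ i) : ℝ)))
    (fun i => (Ncol (φ i) : ℝ) ^ (a - 1) / S)
    (fun i => one_div_pos.mpr (mul_pos hMR (hc (φ i)))) t
  have hent : entropy (fun i => 1 / ((M : ℝ) * (Ncol (φ i) : ℝ))) =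
      Real.log M + (1 / M) * ∑ j, Real.log (Ncol j) := by
    unfold entropy
    rw [sum_comp_eq_sum_card_mul φ Ncol hφ
      (fun j => 1 / ((M : ℝ) * Ncol j) * Real.log (1 / ((M : ℝ) * Ncol j)))]
    have hterm : ∀ j, (Ncol j : ℝ) * (1 / ((M : ℝ) * Ncol j) * Real.log (1 / ((M : ℝ) * Ncol j))) =
        -((1 / M) * (Real.log M + Real.log (Ncol j))) := fun j => by
      rw [one_div ((M : ℝ) * Ncol j), Real.log_inv, Real.log_mul hMR.ne' (hc j).ne']
      have := (hc j).ne'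
      field_simp
    rw [Finset.sum_congr rfl fun j _ => hterm j, Finset.sum_neg_distrib, neg_neg,
      ← Finset.mul_sum, Finset.sum_add_distrib, mul_add]
    simp [hMR.ne']
  refine (((hP.div_const _).add ((hQ.const_mul (1 - a)).div_const _)).sub
    ((((hasDerivAt_id (1 : ℝ)).const_sub 1).mul (hP.sub hR)).div_const _)).congr_deriv ?_
  simp only [Pi.sub_apply, id, Real.one_rpow, sub_self, zero_mul, one_mul, add_zero, hent,
    entropy_uniform hN0, Real.log_div hNR.ne' hMR.ne']
  ring
end
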